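/- Let 1 < p < ∞, δ > 1, let q*(p,δ) be the unique solution x > 1 of ((x/δ)^p − 1)/(x − 1) = p, and let q > q*(p,δ). Then the constant (1/q*(p,δ)) · ((q−1)/(q−q*(p,δ)))^{q−1} is sharp: the supremum, over all weights w ∈ RH_p^δ([0,1]) and all subintervals J ⊂ [0,1], of ⟨w⟩_J · ⟨w^{1−q'}⟩_J^{q−1} equals (1/q*(p,δ)) · ((q−1)/(q−q*(p,δ)))^{q−1}. -/

import Mathlib

open MeasureTheory Set ENNReal

/-- The average `⟨f⟩_{(a,b)}` of an `ℝ≥0∞`-valued function over an interval. -/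
noncomputable def avgE (f : ℝ → ℝ≥0∞) (a b : ℝ) : ℝ≥0∞ :=
  (∫⁻ t in Set.Ioo a b, f t) / ENNReal.ofReal (b - a)

/-- `w ∈ RH_p^δ([A,B])`. -/
def MemRH (p δ A B : ℝ) (w : ℝ → ℝ≥0∞) : Prop :=
  Measurable w ∧ (∫⁻ t in Set.Ioo A B, w t) ≠ ⊤ ∧
    ∀ a b, A ≤ a → a < b → b ≤ B →
      avgE (fun t => w t ^ p) a b ≤ ENNReal.ofReal δ ^ p * (avgE w a b) ^ p

/-! ### One-variable inequalities -/

/-- Weighted AM-GM for the powers `y ^ (p - 1)` and `y ^ (-s - 1)`. -/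
lemma add_le_rpow_add_rpow {p s y : ℝ} (hp : 1 < p) (hs : 0 < s) (hy : 0 < y) :
    p + s ≤ (1 + s) * y ^ (p - 1) + (p - 1) * y ^ (-s - 1) := by
  have h := Real.geom_mean_le_arith_mean2_weighted (w₁ := (1 + s) / (p + s))
    (w₂ := (p - 1) / (p + s)) (p₁ := y ^ (p - 1)) (p₂ := y ^ (-s - 1))
    (by positivity) (div_nonneg (by linarith) (by linarith)) (by positivity) (by positivity)
    (by field_simp; ring)
  rw [← Real.rpow_mul hy.le, ← Real.rpow_mul hy.le, ← Real.rpow_add hy] at h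
  have e : (p - 1) * ((1 + s) / (p + s)) + (-s - 1) * ((p - 1) / (p + s)) = 0 := by
    field_simp; ring
  rw [e, Real.rpow_zero] at h
  have hps : 0 < p + s := by linarith
  have : (p + s) * 1 ≤ (p + s) * ((1 + s) / (p + s) * y ^ (p - 1) +
      (p - 1) / (p + s) * y ^ (-s - 1)) := mul_le_mul_of_nonneg_left h hps.le
  convert this using 1 <;> field_simp

lemma le_of_hasDerivAt_nonneg {g g' : ℝ → ℝ} (hg : ∀ x, 0 < x → HasDerivAt g (g' x) x)
    (hg' : ∀ x, 1 < x → 0 ≤ g' x) {y : ℝ} (hy : 1 ≤ y) : g 1 ≤ g y := by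
  refine monotoneOn_of_deriv_nonneg (convex_Ici (1 : ℝ)) ?_ ?_ ?_ self_mem_Ici hy hy
  · exact fun x hx => (hg x (lt_of_lt_of_le one_pos hx)).continuousAt.continuousWithinAt
  · intro x hx
    rw [interior_Ici] at hx
    exact (hg x (one_pos.trans hx)).differentiableAt.differentiableWithinAt
  · intro x hx
    rw [interior_Ici] at hx
    rw [(hg x (one_pos.trans hx)).deriv]
    exact hg' x hx

lemma tangent_zero_nonneg {p s y : ℝ} (hp : 1 < p) (hs : 0 < s) (hy : 1 ≤ y) :
    0 ≤ (p - 1) * (1 + s) * (p + s) - s * p * (p + s) * y + s * (1 + s) * y ^ p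
      - p * (p - 1) * y ^ (-s) := by
  have h := le_of_hasDerivAt_nonneg
    (g := fun y => (p - 1) * (1 + s) * (p + s) - s * p * (p + s) * y + s * (1 + s) * y ^ p
      - p * (p - 1) * y ^ (-s))
    (g' := fun y => 0 - s * p * (p + s) * 1 + s * (1 + s) * (p * y ^ (p - 1))
      - p * (p - 1) * (-s * y ^ (-s - 1))) ?_ ?_ hy
  · simp only [Real.one_rpow] at h
    refine le_trans (le_of_eq ?_) h
    ring
  · intro x hx
    exact ((((hasDerivAt_const _ _).sub ((hasDerivAt_id x).const_mul _)).add
      ((Real.hasDerivAt_rpow_const (Or.inl hx.ne')).const_mul _))).sub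
      ((Real.hasDerivAt_rpow_const (Or.inl hx.ne')).const_mul _)
  · intro x hx
    have := add_le_rpow_add_rpow hp hs (y := x) (by linarith)
    have h2 : 0 ≤ s * p * ((1 + s) * x ^ (p - 1) + (p - 1) * x ^ (-s - 1) - (p + s)) := by
      apply mul_nonneg
      · positivity
      · linarith
    linarith

lemma remainder_comparison {p s k : ℝ} (hp : 1 < p) (hs : 0 < s) (hk : 1 ≤ k) :
    s * (1 + s) * (1 - (1 + p * (k - 1)) * k ^ (-p)) ≤
      p * (p - 1) * (1 - (1 - s * (k - 1)) * k ^ s) := by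
  have h := le_of_hasDerivAt_nonneg
    (g := fun k => p * (p - 1) * (1 - (1 - s * (k - 1)) * k ^ s) -
      s * (1 + s) * (1 - (1 + p * (k - 1)) * k ^ (-p)))
    (g' := fun k => p * (p - 1) * s * (1 + s) * (k - 1) * (k ^ (s - 1) - k ^ (-p - 1))) ?_ ?_ hk
  · simp only [Real.one_rpow] at h
    linarith
  · intro x hx
    have h1 : HasDerivAt (fun k : ℝ => k - 1) 1 x := (hasDerivAt_id x).sub_const 1
    have h2 : HasDerivAt (fun k : ℝ => k ^ s) (s * x ^ (s - 1)) x :=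
      Real.hasDerivAt_rpow_const (Or.inl hx.ne')
    have h3 : HasDerivAt (fun k : ℝ => k ^ (-p)) (-p * x ^ (-p - 1)) x :=
      Real.hasDerivAt_rpow_const (Or.inl hx.ne')
    have h4 := ((((((h1.const_mul s).const_sub 1).mul h2).const_sub 1).const_mul (p * (p - 1)))).sub
      ((((((h1.const_mul p).const_add 1).mul h3).const_sub 1).const_mul (s * (1 + s))))
    refine h4.congr_deriv ?_
    have e1 : x ^ s = x ^ (s - 1) * x := by
      rw [← Real.rpow_add_one hx.ne']; ring_nf
    have e2 : x ^ (-p) = x ^ (-p - 1) * x := by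
      rw [← Real.rpow_add_one hx.ne']; ring_nf
    rw [e1, e2]
    ring
  · intro x hx
    have : x ^ (-p - 1) ≤ x ^ (s - 1) := Real.rpow_le_rpow_of_exponent_le hx.le (by linarith)
    have h1 : 0 ≤ p * (p - 1) * s * (1 + s) * (x - 1) := by
      have : 0 < p - 1 := by linarith
      have : 0 < x - 1 := by linarith
      positivity
    exact mul_nonneg h1 (by linarith)

lemma tangent_nonneg {p s a y : ℝ} (hp : 1 < p) (hs : 0 < s) (ha : 0 ≤ a)
    (hy : 1 ≤ (1 + a) * y) :
    p * (p - 1) * (1 - a * s) * y ^ (-s) ≤ (p - 1) * (1 + s) * (p + s)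
      - s * p * (p + s) * ((1 + a) * y) + s * (1 + s) * (1 + p * a) * y ^ p := by
  have hy0 : 0 < y := by
    by_contra! h
    nlinarith
  have hM := add_le_rpow_add_rpow hp hs hy0
  have e1 : y ^ p = y ^ (p - 1) * y := by rw [← Real.rpow_add_one hy0.ne']; ring_nf
  have e2 : y ^ (-s) = y ^ (-s - 1) * y := by rw [← Real.rpow_add_one hy0.ne']; ring_nf
  have hM' : 0 ≤ (1 + s) * y ^ p + (p - 1) * y ^ (-s) - (p + s) * y := by
    rw [e1, e2]
    nlinarith
  have key : ∀ b : ℝ, b ≤ a → 0 ≤ (p - 1) * (1 + s) * (p + s)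
      - s * p * (p + s) * ((1 + b) * y) + s * (1 + s) * (1 + p * b) * y ^ p -
      p * (p - 1) * (1 - b * s) * y ^ (-s) →
      p * (p - 1) * (1 - a * s) * y ^ (-s) ≤ (p - 1) * (1 + s) * (p + s)
      - s * p * (p + s) * ((1 + a) * y) + s * (1 + s) * (1 + p * a) * y ^ p := by
    intro b hb h
    have : 0 ≤ (a - b) * (s * p * ((1 + s) * y ^ p + (p - 1) * y ^ (-s) - (p + s) * y)) :=
      mul_nonneg (by linarith) (mul_nonneg (by positivity) hM')
    linarith
  rcases le_total 1 y with h1 | h1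
  · refine key 0 ha ?_
    have := tangent_zero_nonneg hp hs h1
    linarith
  · have hk : 1 ≤ y⁻¹ := (one_le_inv₀ hy0).2 h1
    refine key (y⁻¹ - 1) ?_ ?_
    · have : y⁻¹ ≤ 1 + a := by
        rw [inv_le_iff_one_le_mul₀ hy0]; linarith
      linarith
    · have := remainder_comparison hp hs hk
      rw [Real.inv_rpow hy0.le, Real.inv_rpow hy0.le, ← Real.rpow_neg hy0.le,
        ← Real.rpow_neg hy0.le, neg_neg] at this
      have e : (1 + (y⁻¹ - 1)) * y = 1 := by field_simp; ring
      rw [e]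
      linarith

/-- Coefficients of the supersolution `λ ^ (-s) * (A - D * (w / λ) + c * (w / λ) ^ p)`. -/
lemma exists_supersolution {p s k K : ℝ} (hp : 1 < p) (hs : 0 < s) (hk : 1 < k)
    (hks : (k - 1) * s < 1) (hK : k ^ p = K * (1 + p * (k - 1))) :
    ∃ A D c : ℝ, 0 ≤ c ∧ A - D + c * K = k ^ (-s) / (1 - (k - 1) * s) ∧
      -s * A + (s + 1) * D - (s + p) * c * K = 0 ∧
      ∀ y, 1 ≤ y → y ^ (-s) ≤ A - D * y + c * y ^ p := by
  have hk0 : 0 < k := by linarith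
  have hp1 : 0 < p - 1 := by linarith
  have h1 : 0 < 1 - (k - 1) * s := by linarith
  have hkp : 0 < k ^ p := by positivity
  have hpk : 0 < 1 + p * (k - 1) := by
    have : 0 < k - 1 := by linarith
    positivity
  have hKe : K = k ^ p / (1 + p * (k - 1)) := by field_simp; linarith
  have hkpn : k ^ (-p) * k ^ p = 1 := by rw [← Real.rpow_add hk0]; simp
  set N := k ^ (-s) / (p * (p - 1) * (1 - (k - 1) * s)) with hN
  have hN0 : 0 < N := by positivity
  have hC : k ^ (-s) / (1 - (k - 1) * s) = N * (p * (p - 1)) := by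
    rw [hN]; field_simp
  have hcK : N * s * (1 + s) * (1 + p * (k - 1)) * k ^ (-p) * K = N * s * (1 + s) := by
    rw [hKe]
    have : N * s * (1 + s) * (1 + p * (k - 1)) * k ^ (-p) * (k ^ p / (1 + p * (k - 1))) =
      N * s * (1 + s) * (k ^ (-p) * k ^ p) := by field_simp
    rw [this, hkpn, mul_one]
  refine ⟨N * (p - 1) * (1 + s) * (p + s), N * s * p * (p + s),
    N * s * (1 + s) * (1 + p * (k - 1)) * k ^ (-p), by positivity, ?_, ?_, ?_⟩
  · rw [hcK, hC]; ring
  · linear_combination (-(s + p)) * hcK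
  · intro y hy
    have hy0 : 0 < y := by linarith
    have h := tangent_nonneg (p := p) (s := s) (a := k - 1) (y := y / k) hp hs (by linarith)
      (by rw [add_sub_cancel, mul_div_cancel₀ _ hk0.ne']; exact hy)
    rw [add_sub_cancel, mul_div_cancel₀ _ hk0.ne', Real.div_rpow hy0.le hk0.le,
      Real.div_rpow hy0.le hk0.le, div_eq_mul_inv (y ^ p), ← Real.rpow_neg hk0.le] at h
    have h2 := mul_le_mul_of_nonneg_left h hN0.le
    have e : N * (p * (p - 1) * (1 - (k - 1) * s) * (y ^ (-s) / k ^ (-s))) = y ^ (-s) := by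
      have h3 : k ^ (-s) ≠ 0 := by positivity
      have h4 := h1.ne'
      rw [hN]
      generalize 1 - (k - 1) * s = r at h4
      field_simp
    rw [e] at h2
    linarith

/-! ### Components of bounded open sets and a rising sun lemma -/

lemma exists_Ioo_eq_connectedComponentIn {E : Set ℝ} {a b x : ℝ} (hE : IsOpen E)
    (hEab : E ⊆ Ioo a b) (hx : x ∈ E) :
    ∃ c d, a ≤ c ∧ c < d ∧ d ≤ b ∧ c ∉ E ∧ d ∉ E ∧ connectedComponentIn E x = Ioo c d := by
  set C := connectedComponentIn E x with hC
  have hCo : IsOpen C := hE.connectedComponentIn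
  have hCE : C ⊆ E := connectedComponentIn_subset E x
  have hCc : IsConnected C := isConnected_connectedComponentIn_iff.2 hx
  have hxC : x ∈ C := mem_connectedComponentIn hx
  have hbb : BddBelow C := ⟨a, fun y hy => (hEab (hCE hy)).1.le⟩
  have hba : BddAbove C := ⟨b, fun y hy => (hEab (hCE hy)).2.le⟩
  have hCI : C = Ioo (sInf C) (sSup C) := by
    refine Subset.antisymm ?_ (hCc.Ioo_csInf_csSup_subset hbb hba)
    rw [← interior_Icc]
    exact hCo.subset_interior_iff.2 (subset_Icc_csInf_csSup hbb hba)
  have hlt : sInf C < sSup C := by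
    rw [hCI] at hxC
    exact hxC.1.trans hxC.2
  have hcl : closure C = Icc (sInf C) (sSup C) := by
    conv_lhs => rw [hCI]
    exact closure_Ioo hlt.ne
  have key : ∀ z ∈ closure C, z ∈ E → z ∈ C := by
    intro z hz hzE
    have h1 : IsPreconnected (insert z C) :=
      hCc.isPreconnected.subset_closure (subset_insert z C)
        (insert_subset hz subset_closure)
    exact h1.subset_connectedComponentIn (mem_insert_of_mem _ hxC) (insert_subset hzE hCE)
      (mem_insert z C)
  refine ⟨sInf C, sSup C, le_csInf ⟨x, hxC⟩ fun y hy => (hEab (hCE hy)).1.le, hlt,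
    csSup_le ⟨x, hxC⟩ fun y hy => (hEab (hCE hy)).2.le, fun h => ?_, fun h => ?_, hCI⟩
  · have := key _ (hcl ▸ left_mem_Icc.2 hlt.le) h
    rw [hCI] at this
    exact lt_irrefl _ (this.1.trans_eq (by rw [← hCI]))
  · have := key _ (hcl ▸ right_mem_Icc.2 hlt.le) h
    rw [hCI] at this
    exact lt_irrefl _ (this.2.trans_eq' (by rw [← hCI]))

lemma setIntegral_nonneg_of_components {E : Set ℝ} {a b : ℝ} {g : ℝ → ℝ} (hE : IsOpen E)
    (hEab : E ⊆ Ioo a b) (hg : IntegrableOn g E)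
    (h : ∀ c d, a ≤ c → c < d → d ≤ b → c ∉ E → d ∉ E → Ioo c d ⊆ E →
      0 ≤ ∫ x in Ioo c d, g x) : 0 ≤ ∫ x in E, g x := by
  set T : Set (Set ℝ) := connectedComponentIn E '' E with hT
  have hdisj : T.PairwiseDisjoint id := by
    rintro _ ⟨x, hx, rfl⟩ _ ⟨y, hy, rfl⟩ hne
    by_contra hd
    obtain ⟨z, hz1, hz2⟩ := Set.not_disjoint_iff.1 hd
    exact hne ((connectedComponentIn_eq hz1).trans (connectedComponentIn_eq hz2).symm)
  have hopen : ∀ s ∈ T, IsOpen (id s) := by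
    rintro _ ⟨x, hx, rfl⟩
    exact hE.connectedComponentIn
  have hcount : T.Countable := hdisj.countable_of_isOpen hopen (by
    rintro _ ⟨x, hx, rfl⟩
    exact ⟨x, mem_connectedComponentIn hx⟩)
  have hEU : E = ⋃ s : T, (s : Set ℝ) := by
    ext x
    simp only [mem_iUnion]
    constructor
    · exact fun hx => ⟨⟨_, x, hx, rfl⟩, mem_connectedComponentIn hx⟩
    · rintro ⟨⟨_, y, hy, rfl⟩, hx⟩
      exact connectedComponentIn_subset _ _ hx
  have := hcount.to_subtype
  rw [hEU, integral_iUnion (s := fun s : T => (s : Set ℝ))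
    (fun s => (hopen s s.2).measurableSet) ?_ (by rwa [← hEU])]
  · refine tsum_nonneg ?_
    rintro ⟨_, x, hx, rfl⟩
    obtain ⟨c, d, hac, hcd, hdb, hc, hd, e⟩ := exists_Ioo_eq_connectedComponentIn hE hEab hx
    simp only [e]
    exact h c d hac hcd hdb hc hd (e ▸ connectedComponentIn_subset _ _)
  · intro s t hst
    exact hdisj s.2 t.2 (fun h => hst (Subtype.ext h))

/-- The points of `(a, b)` in the shadow of `G`, for light coming from the right at height
at most `max 0 G`. -/
def shadow (G : ℝ → ℝ) (a b : ℝ) : Set ℝ :=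
  {x | x ∈ Ioo a b ∧ ∃ y, x < y ∧ y ≤ b ∧ G y < max 0 (G x)}

lemma shadow_component_eq {G : ℝ → ℝ} {a b c d : ℝ} (hG : Continuous G) (hGa : G a = 0)
    (hGb : 0 ≤ G b) (hac : a ≤ c) (hcd : c < d) (hdb : d ≤ b) (hc : c ∉ shadow G a b)
    (hd : d ∉ shadow G a b) (hsub : Ioo c d ⊆ shadow G a b) : G c = G d := by
  have hout : ∀ x ∈ Ioo a b, x ∉ shadow G a b → ∀ y, x < y → y ≤ b → 0 ≤ G y ∧ G x ≤ G y := by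
    intro x hx hxs y hxy hyb
    by_contra hcon
    refine hxs ⟨hx, y, hxy, hyb, ?_⟩
    rw [not_and_or, not_le, not_le] at hcon
    exact lt_max_iff.2 hcon
  have hd1 : ∀ y, d ≤ y → y ≤ b → G d ≤ G y := by
    intro y hdy hyb
    rcases hdy.eq_or_lt with rfl | hdy
    · exact le_rfl
    · exact (hout d ⟨by linarith, by linarith⟩ hd y hdy hyb).2
  have hnonneg : ∀ x, a < x → x ≤ b → x ∉ shadow G a b → 0 ≤ G x := by
    intro x hax hxb hx
    rcases hxb.eq_or_lt with rfl | hxb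
    · exact hGb
    · by_contra! hneg
      have hev : ∀ᶠ y in nhdsWithin x (Ioi x), G y < 0 :=
        (hG.tendsto x).mono_left nhdsWithin_le_nhds |>.eventually_lt_const hneg
      have hev2 : ∀ᶠ y in nhdsWithin x (Ioi x), y ∈ Ioo x b := Ioo_mem_nhdsGT hxb
      obtain ⟨y, h1, h2⟩ := (hev.and hev2).exists
      exact absurd (hout x ⟨hax, hxb⟩ hx y h2.1 h2.2.le).1 (not_le.2 h1)
  have hGd : 0 ≤ G d := hnonneg d (by linarith) hdb hd
  have hGc : 0 ≤ G c := by
    rcases hac.eq_or_lt with rfl | hac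
    · exact hGa.ge
    · exact hnonneg c hac (by linarith) hc
  have h1 : G c ≤ G d := by
    rcases hac.eq_or_lt with rfl | hac
    · exact hGa.trans_le hGd
    · exact (hout c ⟨hac, by linarith⟩ hc d hcd hdb).2
  refine le_antisymm h1 ?_
  by_contra! hlt
  have hev : ∀ᶠ y in nhdsWithin c (Ioi c), G y < G d :=
    (hG.tendsto c).mono_left nhdsWithin_le_nhds |>.eventually_lt_const hlt
  have hev2 : ∀ᶠ y in nhdsWithin c (Ioi c), y ∈ Ioo c d := Ioo_mem_nhdsGT hcd
  obtain ⟨x, hx1, hx2⟩ := (hev.and hev2).exists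
  have hM : max 0 (G x) < G d := max_lt (hGc.trans_lt hlt) hx1
  have hcomp : IsCompact (Icc x d ∩ {t | G t ≤ max 0 (G x)}) :=
    isCompact_Icc.inter_right (isClosed_le hG continuous_const)
  obtain ⟨z, ⟨⟨hxz, hzd⟩, hz⟩, hzmax⟩ := hcomp.exists_isGreatest
    ⟨x, left_mem_Icc.2 hx2.2.le, show G x ≤ max 0 (G x) from le_max_right _ _⟩
  have hz' : G z ≤ max 0 (G x) := hz
  have hzd' : z < d := lt_of_le_of_ne hzd (by rintro rfl; exact absurd hz' (not_le.2 hM))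
  obtain ⟨-, y, hzy, hyb, hy⟩ := hsub ⟨hx2.1.trans_le hxz, hzd'⟩
  have hy' : G y ≤ max 0 (G x) := hy.le.trans (max_le (le_max_left _ _) hz')
  rcases le_or_gt y d with hyd | hyd
  · exact absurd (hzmax ⟨⟨hxz.trans hzy.le, hyd⟩, hy'⟩) (not_le.2 hzy)
  · exact absurd ((hd1 y hyd.le hyb).trans hy') (not_le.2 hM)

/-! ### Level sets of the averages of a weight -/

/-- The shadow of `x ↦ ∫ t in a..x, f t - l`; outside it `f` is at least `l`, and `f` has mean `l`
on each of its components. -/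
def lowSet (f : ℝ → ℝ) (a b l : ℝ) : Set ℝ :=
  shadow (fun x => (∫ t in a..x, f t) - l * (x - a)) a b

section lowSet

variable {f : ℝ → ℝ} {a b : ℝ}

lemma lowSet_subset (l : ℝ) : lowSet f a b l ⊆ Ioo a b := fun _ hx => hx.1

lemma lowSet_mono {l m : ℝ} (hlm : l ≤ m) : lowSet f a b l ⊆ lowSet f a b m := by
  rintro x ⟨hx, y, hxy, hyb, h⟩
  refine ⟨hx, y, hxy, hyb, ?_⟩
  rw [lt_max_iff] at h ⊢
  rcases h with h | h
  · left
    nlinarith [mul_nonneg (sub_nonneg.2 hlm) (sub_nonneg.2 (hx.1.trans hxy).le)]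
  · right
    nlinarith [mul_nonneg (sub_nonneg.2 hlm) (sub_nonneg.2 hxy.le)]

lemma isOpen_lowSet_prod (hf : Integrable f) :
    IsOpen {z : ℝ × ℝ | z.1 ∈ lowSet f a b z.2} := by
  have hF : Continuous fun x => ∫ t in a..x, f t :=
    intervalIntegral.continuous_primitive (fun _ _ => hf.intervalIntegrable) a
  have : {z : ℝ × ℝ | z.1 ∈ lowSet f a b z.2} = ⋃ y : ℝ, ⋃ _ : y ≤ b,
      ({z : ℝ × ℝ | a < z.1} ∩ {z | z.1 < b} ∩ {z | z.1 < y} ∩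
        {z | (∫ t in a..y, f t) - z.2 * (y - a) <
          max 0 ((∫ t in a..z.1, f t) - z.2 * (z.1 - a))}) := by
    ext z
    simp only [lowSet, shadow, mem_ofPred_eq, mem_iUnion, mem_inter_iff, mem_Ioo, exists_prop]
    constructor
    · rintro ⟨⟨h1, h2⟩, y, h3, h4, h5⟩
      exact ⟨y, h4, ⟨⟨h1, h2⟩, h3⟩, h5⟩
    · rintro ⟨y, h4, ⟨⟨h1, h2⟩, h3⟩, h5⟩
      exact ⟨⟨h1, h2⟩, y, h3, h4, h5⟩
  rw [this]
  refine isOpen_iUnion fun y => isOpen_iUnion fun _ => ?_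
  refine (((isOpen_lt continuous_const continuous_fst).inter
    (isOpen_lt continuous_fst continuous_const)).inter
    (isOpen_lt continuous_fst continuous_const)).inter (isOpen_lt ?_ ?_)
  · fun_prop
  · exact continuous_const.max ((hF.comp continuous_fst).sub
      (continuous_snd.mul (continuous_fst.sub continuous_const)))

lemma isOpen_lowSet (hf : Integrable f) (l : ℝ) : IsOpen (lowSet f a b l) :=
  (isOpen_lowSet_prod hf).preimage (f := fun x : ℝ => (x, l)) (by fun_prop)

lemma ae_le_of_notMem_lowSet (hf : Integrable f) :
    ∀ᵐ x, x ∈ Ioo a b → ∀ l, x ∉ lowSet f a b l → l ≤ f x := by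
  filter_upwards [LocallyIntegrable.ae_hasDerivAt_integral hf.locallyIntegrable] with x hx hxab l hl
  have h1 := (hasDerivAt_iff_tendsto_slope.1 (hx a)).mono_left
    (nhdsWithin_mono x (show Ioi x ⊆ {x}ᶜ from fun y hy => (mem_Ioi.1 hy).ne'))
  refine ge_of_tendsto h1 ?_
  filter_upwards [Ioo_mem_nhdsGT hxab.2] with y hy
  rw [slope_def_field, le_div_iff₀ (sub_pos.2 hy.1)]
  by_contra! hcon
  refine hl ⟨hxab, y, hy.1, hy.2.le, lt_max_of_lt_right ?_⟩
  linarith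

lemma setIntegral_lowSet_nonneg {p K l q₀ q₁ q₂ : ℝ} (hf : Integrable f)
    (hfp : Integrable fun x => f x ^ p) (hl : l * (b - a) ≤ ∫ t in a..b, f t)
    (hRH : ∀ c d, a ≤ c → c < d → d ≤ b → ∫ x in Ioo c d, f x ^ p ≤
      K * (d - c) * ((∫ x in Ioo c d, f x) / (d - c)) ^ p)
    (hq₂ : q₂ ≤ 0) (hq : 0 ≤ q₀ + q₁ * l + q₂ * (K * l ^ p)) :
    0 ≤ ∫ x in lowSet f a b l, (q₀ + q₁ * f x + q₂ * f x ^ p) := by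
  have hF : Continuous fun x => ∫ t in a..x, f t :=
    intervalIntegral.continuous_primitive (fun _ _ => hf.intervalIntegrable) a
  have hfin : ∀ c d, c < d → IntegrableOn (fun _ : ℝ => q₀) (Ioo c d) := fun c d _ =>
    integrableOn_const (by simp)
  refine setIntegral_nonneg_of_components (isOpen_lowSet hf l) (lowSet_subset l) ?_ ?_
  · refine Integrable.add (Integrable.add ?_ (hf.const_mul _).integrableOn)
      (hfp.const_mul _).integrableOn
    exact IntegrableOn.mono_set (integrableOn_const (s := Ioo a b) (by simp)) (lowSet_subset l)
  · intro c d hac hcd hdb hc hd hsub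
    have hcd' : 0 < d - c := sub_pos.2 hcd
    have h := shadow_component_eq (G := fun x => (∫ t in a..x, f t) - l * (x - a))
      (by fun_prop) (by simp) (by simpa using hl) hac hcd hdb hc hd hsub
    have hint : ∫ x in Ioo c d, f x = l * (d - c) := by
      rw [← integral_Ioc_eq_integral_Ioo, ← intervalIntegral.integral_of_le hcd.le,
        ← intervalIntegral.integral_interval_sub_left (a := a) hf.intervalIntegrable
          hf.intervalIntegrable]
      linarith
    have hR := hRH c d hac hcd hdb
    rw [hint, mul_div_cancel_right₀ _ hcd'.ne'] at hR
    have e1 : ∫ x in Ioo c d, (q₀ + q₁ * f x + q₂ * f x ^ p) =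
        (d - c) * q₀ + q₁ * (l * (d - c)) + q₂ * ∫ x in Ioo c d, f x ^ p := by
      have i0 := hfin c d hcd
      have i1 : IntegrableOn (fun x => q₁ * f x) (Ioo c d) := (hf.const_mul _).integrableOn
      have i2 : IntegrableOn (fun x => q₂ * f x ^ p) (Ioo c d) := (hfp.const_mul _).integrableOn
      have i3 : IntegrableOn (fun x => q₀ + q₁ * f x) (Ioo c d) := i0.add i1
      rw [integral_add i3 i2, integral_add i0 i1, integral_const_mul, integral_const_mul, hint]
      simp [hcd.le]
    rw [e1]
    have h2 := mul_le_mul_of_nonpos_left hR hq₂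
    nlinarith [mul_nonneg hcd'.le hq]

end lowSet

/-! ### The supersolution along the level sets -/

/-- The tangent plane, at level `l`, of the supersolution with coefficients `A`, `D`, `c`. -/
noncomputable def tangentPlane (p s A D c l w : ℝ) : ℝ :=
  A * l ^ (-s) - D * l ^ (-s - 1) * w + c * l ^ (-s - p) * w ^ p

/-- The derivative of `tangentPlane` in the level. -/
noncomputable def tangentPlaneDeriv (p s A D c l w : ℝ) : ℝ :=
  A * (-s * l ^ (-s - 1)) - D * ((-s - 1) * l ^ (-s - 1 - 1)) * w +
    c * ((-s - p) * l ^ (-s - p - 1)) * w ^ p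

section tangentPlane

variable {p s A D c : ℝ}

lemma hasDerivAt_tangentPlane {l : ℝ} (hl : 0 < l) (w : ℝ) :
    HasDerivAt (fun l => tangentPlane p s A D c l w) (tangentPlaneDeriv p s A D c l w) l := by
  have h : ∀ r : ℝ, HasDerivAt (fun l : ℝ => l ^ r) (r * l ^ (r - 1)) l := fun r =>
    Real.hasDerivAt_rpow_const (Or.inl hl.ne')
  exact (((h (-s)).const_mul A).sub (((h (-s - 1)).const_mul D).mul_const w)).add
    (((h (-s - p)).const_mul c).mul_const (w ^ p))

lemma continuousOn_tangentPlaneDeriv (w : ℝ) :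
    ContinuousOn (fun l => tangentPlaneDeriv p s A D c l w) (Ioi 0) := by
  have h : ∀ r : ℝ, ContinuousOn (fun l : ℝ => l ^ r) (Ioi 0) := fun r l hl =>
    (Real.continuousAt_rpow_const l r (Or.inl (ne_of_gt hl))).continuousWithinAt
  unfold tangentPlaneDeriv
  have h1 := h (-s - 1)
  have h2 := h (-s - 1 - 1)
  have h3 := h (-s - p - 1)
  fun_prop

lemma rpow_neg_le_tangentPlane (hy : ∀ y, 1 ≤ y → y ^ (-s) ≤ A - D * y + c * y ^ p) {l w : ℝ}
    (hl : 0 < l) (hw : l ≤ w) : w ^ (-s) ≤ tangentPlane p s A D c l w := by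
  have hw0 : 0 < w := hl.trans_le hw
  have h := mul_le_mul_of_nonneg_left (hy (w / l) ((one_le_div hl).2 hw))
    (Real.rpow_nonneg hl.le (-s))
  rw [Real.div_rpow hw0.le hl.le, Real.div_rpow hw0.le hl.le,
    mul_div_cancel₀ _ (Real.rpow_pos_of_pos hl _).ne'] at h
  refine h.trans_eq ?_
  rw [tangentPlane, Real.rpow_sub hl, Real.rpow_sub hl, Real.rpow_one]
  ring

lemma le_tangentPlane_of_nonneg (hp : 1 < p) (hc : 0 ≤ c)
    (hy : ∀ y, 1 ≤ y → y ^ (-s) ≤ A - D * y + c * y ^ p) {l w : ℝ}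
    (hl : 0 < l) (hw : 0 ≤ w) :
    l ^ (-s) + (c * p - D) * l ^ (-s - 1) * (w - l) ≤ tangentPlane p s A D c l w := by
  have h1 : 1 ≤ A - D + c := by simpa using hy 1 le_rfl
  have hB := one_add_mul_self_le_rpow_one_add (s := w / l - 1) (p := p)
    (by linarith [div_nonneg hw hl.le]) hp.le
  rw [add_sub_cancel, Real.div_rpow hw hl.le] at hB
  have h2 := mul_le_mul_of_nonneg_left (add_le_add h1 (mul_le_mul_of_nonneg_left hB hc))
    (Real.rpow_nonneg hl.le (-s))
  have hlp : 0 < l ^ p := Real.rpow_pos_of_pos hl p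
  rw [tangentPlane, Real.rpow_sub hl, Real.rpow_sub hl, Real.rpow_one]
  have e : l ^ (-s) + (c * p - D) * (l ^ (-s) / l) * (w - l) =
      l ^ (-s) * (1 + c * (1 + p * (w / l - 1))) - l ^ (-s) * (c + D * (w / l - 1)) := by
    field_simp
    ring
  have e2 : A * l ^ (-s) - D * (l ^ (-s) / l) * w + c * (l ^ (-s) / l ^ p) * w ^ p =
      l ^ (-s) * (A - D + c + c * (w ^ p / l ^ p)) - l ^ (-s) * (c + D * (w / l - 1)) := by
    field_simp
    ring
  rw [e, e2]
  linarith

end tangentPlane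

/-- Integrating the supersolution over the levels for which a given point is low. -/
lemma exists_setIntegral_tangentPlaneDeriv {p s A D c ε l w : ℝ} (hε : 0 < ε) (hεl : ε < l)
    {T : Set ℝ} (hT : MeasurableSet T) (hmono : ∀ μ ν, μ ∈ T → μ ≤ ν → ν ∈ T) :
    ∃ Λ, ε ≤ Λ ∧ Λ ≤ l ∧ (∀ μ, ε ≤ μ → μ < Λ → μ ∉ T) ∧ (ε ∈ T → Λ = ε) ∧
      ∫ μ in Ioo ε l, T.indicator (fun μ => tangentPlaneDeriv p s A D c μ w) μ =
        tangentPlane p s A D c l w - tangentPlane p s A D c Λ w := by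
  have hne : (insert l (T ∩ Ico ε l)).Nonempty := insert_nonempty _ _
  have hbdd : BddBelow (insert l (T ∩ Ico ε l)) := by
    refine ⟨ε, ?_⟩
    rintro y (rfl | hy)
    · exact hεl.le
    · exact hy.2.1
  set Λ := sInf (insert l (T ∩ Ico ε l)) with hΛ
  have hεΛ : ε ≤ Λ := by
    refine le_csInf hne ?_
    rintro y (rfl | hy)
    · exact hεl.le
    · exact hy.2.1
  have hΛl : Λ ≤ l := csInf_le hbdd (mem_insert _ _)
  have hlow : ∀ μ, ε ≤ μ → μ < Λ → μ ∉ T := fun μ h1 h2 h3 =>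
    absurd (csInf_le hbdd (mem_insert_of_mem _ ⟨h3, h1, h2.trans_le hΛl⟩)) (not_le.2 h2)
  have hhigh : ∀ μ, Λ < μ → μ < l → μ ∈ T := by
    intro μ h1 h2
    obtain ⟨ν, hν, hνμ⟩ := exists_lt_of_csInf_lt hne h1
    rcases hν with rfl | hν
    · exact absurd hνμ (not_lt.2 h2.le)
    · exact hmono ν μ hν.1 hνμ.le
  refine ⟨Λ, hεΛ, hΛl, hlow, fun h => ?_, ?_⟩
  · exact le_antisymm (csInf_le hbdd (mem_insert_of_mem _ ⟨h, le_rfl, hεl⟩)) hεΛ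
  · rw [setIntegral_indicator hT]
    have hae : (Ioo ε l ∩ T : Set ℝ) =ᵐ[volume] Ioc Λ l := by
      have h1 : Ioo Λ l ⊆ Ioo ε l ∩ T := fun μ hμ =>
        ⟨⟨hεΛ.trans_lt hμ.1, hμ.2⟩, hhigh μ hμ.1 hμ.2⟩
      have h2 : (Ioo ε l ∩ T : Set ℝ) ⊆ Icc Λ l := fun μ hμ =>
        ⟨not_lt.1 fun h => hlow μ hμ.1.1.le h hμ.2, hμ.1.2.le⟩
      refine Filter.EventuallyLE.antisymm ?_ ?_
      · exact h2.eventuallyLE.trans Ioc_ae_eq_Icc.symm.le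
      · exact Ioo_ae_eq_Ioc.symm.le.trans h1.eventuallyLE
    rw [setIntegral_congr_set hae, ← intervalIntegral.integral_of_le hΛl]
    have hpos : uIcc Λ l ⊆ Ioi 0 := by
      rw [uIcc_of_le hΛl]
      exact fun μ hμ => hε.trans_le (hεΛ.trans hμ.1)
    exact intervalIntegral.integral_eq_sub_of_hasDerivAt
      (fun μ hμ => hasDerivAt_tangentPlane (hpos hμ) w)
      ((continuousOn_tangentPlaneDeriv w).mono hpos).intervalIntegrable

section truncated

variable {f : ℝ → ℝ} {a b p s K l ε A D c : ℝ}

lemma integrable_tangentPlaneDeriv_prod (hf : Integrable f) (hfp : Integrable fun x => f x ^ p)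
    (hε : 0 < ε) :
    Integrable (fun z : ℝ × ℝ => {z : ℝ × ℝ | z.1 ∈ lowSet f a b z.2}.indicator
      (fun z => tangentPlaneDeriv p s A D c z.2 (f z.1)) z)
      ((volume.restrict (Ioo a b)).prod (volume.restrict (Ioo ε l))) := by
  refine Integrable.indicator ?_ (isOpen_lowSet_prod hf).measurableSet
  have h : ∀ k r : ℝ, Integrable (fun μ : ℝ => k * μ ^ r) (volume.restrict (Ioo ε l)) := by
    intro k r
    refine Integrable.const_mul ?_ k
    refine IntegrableOn.mono_set (ContinuousOn.integrableOn_Icc ?_) Ioo_subset_Icc_self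
    exact fun μ hμ =>
      (Real.continuousAt_rpow_const μ r (Or.inl (hε.trans_le hμ.1).ne')).continuousWithinAt
  have h0 : Integrable (fun _ : ℝ => (1 : ℝ)) (volume.restrict (Ioo a b)) :=
    integrableOn_const (by simp)
  have i0 := h0.mul_prod (h (A * -s) (-s - 1))
  have i1 := (hf.restrict (s := Ioo a b)).mul_prod (h (D * (-s - 1)) (-s - 1 - 1))
  have i2 := (hfp.restrict (s := Ioo a b)).mul_prod (h (c * (-s - p)) (-s - p - 1))
  refine ((i0.sub i1).add i2).congr (Filter.Eventually.of_forall fun z => ?_)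
  simp only [Pi.add_apply, Pi.sub_apply, tangentPlaneDeriv]
  ring

lemma truncated_estimate (hp : 1 < p) (hs : 0 < s) (hab : a < b)
    (hc : 0 ≤ c) (hcrit : -s * A + (s + 1) * D - (s + p) * c * K = 0)
    (hy : ∀ y, 1 ≤ y → y ^ (-s) ≤ A - D * y + c * y ^ p)
    (hf0 : ∀ x, 0 ≤ f x) (hf : Integrable f) (hfp : Integrable fun x => f x ^ p)
    (hl : ∫ x in Ioo a b, f x = l * (b - a))
    (hRH : ∀ c d, a ≤ c → c < d → d ≤ b → ∫ x in Ioo c d, f x ^ p ≤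
      K * (d - c) * ((∫ x in Ioo c d, f x) / (d - c)) ^ p)
    (hε : 0 < ε) (hεl : ε < l) :
    ENNReal.ofReal (ε ^ (-s)) * volume (lowSet f a b ε) ≤
        ENNReal.ofReal ((A - D + c * K) * l ^ (-s) * (b - a)) ∧
      ∫⁻ x in Ioo a b \ lowSet f a b ε, ENNReal.ofReal (f x ^ (-s)) ≤
        ENNReal.ofReal ((A - D + c * K) * l ^ (-s) * (b - a)) := by
  have hl0 : 0 < l := hε.trans hεl
  have hba : 0 < b - a := sub_pos.2 hab
  set E := lowSet f a b ε with hE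
  have hEm : MeasurableSet E := (isOpen_lowSet hf ε).measurableSet
  have hEab : E ⊆ Ioo a b := lowSet_subset ε
  have hlF : l * (b - a) = ∫ t in a..b, f t := by
    rw [intervalIntegral.integral_of_le hab.le, integral_Ioc_eq_integral_Ioo, hl]
  have hfin : volume E ≠ ⊤ := ((measure_mono hEab).trans_lt (by simp)).ne
  have hprod := integrable_tangentPlaneDeriv_prod (a := a) (b := b) (s := s) (l := l)
    (A := A) (D := D) (c := c) hf hfp hε
  set R : ℝ → ℝ := fun x => ∫ μ in Ioo ε l, {z : ℝ × ℝ | z.1 ∈ lowSet f a b z.2}.indicator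
      (fun z => tangentPlaneDeriv p s A D c z.2 (f z.1)) (x, μ) with hR
  have hRi : IntegrableOn R (Ioo a b) := hprod.integral_prod_left
  have hR0 : 0 ≤ ∫ x in Ioo a b, R x := by
    rw [hR, integral_integral_swap hprod]
    refine setIntegral_nonneg measurableSet_Ioo fun μ hμ => ?_
    have hμ0 : 0 < μ := hε.trans hμ.1
    have e : ∀ x, {z : ℝ × ℝ | z.1 ∈ lowSet f a b z.2}.indicator
        (fun z => tangentPlaneDeriv p s A D c z.2 (f z.1)) (x, μ) =
        (lowSet f a b μ).indicator (fun x => A * (-s * μ ^ (-s - 1)) +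
          -(D * ((-s - 1) * μ ^ (-s - 1 - 1))) * f x +
          c * ((-s - p) * μ ^ (-s - p - 1)) * f x ^ p) x := by
      intro x
      by_cases hx : x ∈ lowSet f a b μ
      · rw [indicator_of_mem hx, indicator_of_mem (show (x, μ) ∈ _ from hx), tangentPlaneDeriv]
        ring
      · rw [indicator_of_notMem hx, indicator_of_notMem (show (x, μ) ∉ _ from hx)]
    simp only [e]
    rw [setIntegral_indicator (isOpen_lowSet hf μ).measurableSet,
      inter_eq_self_of_subset_right (lowSet_subset μ)]
    refine setIntegral_lowSet_nonneg hf hfp ?_ hRH ?_ ?_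
    · rw [← hlF]
      exact mul_le_mul_of_nonneg_right hμ.2.le hba.le
    · have : 0 ≤ c * ((s + p) * μ ^ (-s - p - 1)) := by positivity
      linarith
    · have e1 : μ ^ (-s - 1 - 1) * μ = μ ^ (-s - 1) := by
        rw [← Real.rpow_add_one hμ0.ne']; ring_nf
      have e2 : μ ^ (-s - p - 1) * μ ^ p = μ ^ (-s - 1) := by
        rw [← Real.rpow_add hμ0]; ring_nf
      have e3 : A * (-s * μ ^ (-s - 1)) + -(D * ((-s - 1) * μ ^ (-s - 1 - 1))) * μ +
          c * ((-s - p) * μ ^ (-s - p - 1)) * (K * μ ^ p) = μ ^ (-s - 1) *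
          (-s * A + (s + 1) * D - (s + p) * c * K) := by
        linear_combination D * (s + 1) * e1 - c * (s + p) * K * e2
      rw [e3, hcrit, mul_zero]
  have i0 : ∀ k : ℝ, IntegrableOn (fun _ : ℝ => k) (Ioo a b) := fun k =>
    integrableOn_const (by simp)
  have i1 : ∀ k, IntegrableOn (fun x => k * f x) (Ioo a b) := fun k =>
    (hf.const_mul k).integrableOn
  have i2 : ∀ k, IntegrableOn (fun x => k * f x ^ p) (Ioo a b) := fun k =>
    (hfp.const_mul k).integrableOn
  have i3 : IntegrableOn (fun x => A * l ^ (-s) - D * l ^ (-s - 1) * f x) (Ioo a b) :=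
    (i0 _).sub (i1 _)
  have hPi : IntegrableOn (fun x => tangentPlane p s A D c l (f x)) (Ioo a b) := i3.add (i2 _)
  have hP : ∫ x in Ioo a b, tangentPlane p s A D c l (f x) ≤
      (A - D + c * K) * l ^ (-s) * (b - a) := by
    simp only [tangentPlane]
    rw [integral_add i3 (i2 _), integral_sub (i0 _) (i1 _), integral_const_mul (D * l ^ (-s - 1)),
      integral_const_mul (c * l ^ (-s - p)), hl]
    have hRab := hRH a b le_rfl hab le_rfl
    rw [hl, mul_div_cancel_right₀ _ hba.ne'] at hRab
    have h2 := mul_le_mul_of_nonneg_left hRab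
      (mul_nonneg hc (Real.rpow_nonneg hl0.le (-s - p)))
    have e1 : l ^ (-s - 1) * l = l ^ (-s) := by
      rw [← Real.rpow_add_one hl0.ne']; ring_nf
    have e2 : l ^ (-s - p) * l ^ p = l ^ (-s) := by
      rw [← Real.rpow_add hl0]; ring_nf
    have e3 : ∫ _ in Ioo a b, A * l ^ (-s) = (b - a) * (A * l ^ (-s)) := by simp [hab.le]
    rw [e3]
    refine (add_le_add_right h2 _).trans_eq ?_
    linear_combination -D * (b - a) * e1 + c * K * (b - a) * e2
  have hpt : ∀ x, ∃ Λ, ε ≤ Λ ∧ (∀ μ, ε ≤ μ → μ < Λ → x ∉ lowSet f a b μ) ∧ (x ∈ E → Λ = ε) ∧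
      tangentPlane p s A D c l (f x) - R x = tangentPlane p s A D c Λ (f x) := by
    intro x
    obtain ⟨Λ, h1, -, h2, h3, h4⟩ := exists_setIntegral_tangentPlaneDeriv (p := p) (s := s)
      (A := A) (D := D) (c := c) (w := f x) hε hεl
      (T := (fun μ => (x, μ)) ⁻¹' {z : ℝ × ℝ | z.1 ∈ lowSet f a b z.2})
      ((isOpen_lowSet_prod hf).preimage (by fun_prop)).measurableSet
      (fun μ ν hμ hμν => lowSet_mono hμν hμ)
    refine ⟨Λ, h1, h2, h3, ?_⟩
    have : R x = tangentPlane p s A D c l (f x) - tangentPlane p s A D c Λ (f x) := h4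
    rw [this]
    ring
  set S : ℝ → ℝ := fun x => tangentPlane p s A D c l (f x) - R x with hS
  have hSi : IntegrableOn S (Ioo a b) := hPi.sub hRi
  have hSle : ∫ x in Ioo a b, S x ≤ (A - D + c * K) * l ^ (-s) * (b - a) := by
    rw [hS, integral_sub hPi hRi]
    linarith
  have hSE : ε ^ (-s) * volume.real E ≤ ∫ x in E, S x := by
    have h1 := setIntegral_lowSet_nonneg (l := ε) (q₀ := -((c * p - D) * ε ^ (-s - 1) * ε))
      (q₁ := (c * p - D) * ε ^ (-s - 1)) (q₂ := 0) hf hfp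
      (by rw [← hlF]; exact mul_le_mul_of_nonneg_right hεl.le hba.le) hRH le_rfl
      (by linarith)
    have j0 : ∀ k : ℝ, IntegrableOn (fun _ : ℝ => k) E := fun k => integrableOn_const hfin
    have j1 : IntegrableOn (fun x => -((c * p - D) * ε ^ (-s - 1) * ε) +
        (c * p - D) * ε ^ (-s - 1) * f x + 0 * f x ^ p) E :=
      ((j0 _).add ((i1 _).mono_set hEab)).add ((i2 _).mono_set hEab)
    have h2 : ∫ x in E, (ε ^ (-s) + (-((c * p - D) * ε ^ (-s - 1) * ε) +
        (c * p - D) * ε ^ (-s - 1) * f x + 0 * f x ^ p)) ≤ ∫ x in E, S x := by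
      refine setIntegral_mono_on ((j0 _).add j1) (hSi.mono_set hEab) hEm fun x hx => ?_
      obtain ⟨Λ, -, -, h3, h4⟩ := hpt x
      rw [hS]
      simp only
      rw [h4, h3 hx]
      refine le_trans (le_of_eq ?_) (le_tangentPlane_of_nonneg hp hc hy hε (hf0 x))
      ring
    rw [integral_add (j0 _) j1] at h2
    have h3 : ∫ _ in E, ε ^ (-s) = ε ^ (-s) * volume.real E := by simp [mul_comm]
    linarith
  have hSF : ∀ᵐ x ∂volume.restrict (Ioo a b \ E), f x ^ (-s) ≤ S x := by
    rw [ae_restrict_iff' (measurableSet_Ioo.diff hEm)]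
    filter_upwards [ae_le_of_notMem_lowSet (a := a) (b := b) hf] with x hx hxm
    obtain ⟨Λ, h1, h2, -, h4⟩ := hpt x
    rw [hS]
    simp only
    rw [h4]
    refine rpow_neg_le_tangentPlane hy (hε.trans_le h1) ?_
    by_contra! hlt
    have hεf : ε ≤ f x := hx hxm.1 ε hxm.2
    have := hx hxm.1 ((f x + Λ) / 2) (h2 _ (by linarith) (by linarith))
    linarith
  have hSF0 : 0 ≤ᵐ[volume.restrict (Ioo a b \ E)] S :=
    hSF.mono fun x hx => (Real.rpow_nonneg (hf0 x) _).trans hx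
  have hsum : (∫ x in E, S x) + ∫ x in Ioo a b \ E, S x = ∫ x in Ioo a b, S x := by
    have := integral_inter_add_sdiff (s := Ioo a b) hEm hSi
    rwa [inter_eq_self_of_subset_right hEab] at this
  have hF0 : 0 ≤ ∫ x in Ioo a b \ E, S x := integral_nonneg_of_ae hSF0
  have hE0 : 0 ≤ ε ^ (-s) * volume.real E := by positivity
  constructor
  · rw [← ENNReal.ofReal_toReal hfin, ← ENNReal.ofReal_mul (by positivity)]
    refine ENNReal.ofReal_le_ofReal ?_
    change ε ^ (-s) * volume.real E ≤ _
    linarith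
  · refine (lintegral_mono_ae (hSF.mono fun x hx => ENNReal.ofReal_le_ofReal hx)).trans ?_
    rw [← ofReal_integral_eq_lintegral_ofReal (hSi.mono_set sdiff_subset) hSF0]
    refine ENNReal.ofReal_le_ofReal ?_
    linarith

end truncated

section bound

variable {f : ℝ → ℝ} {a b p s K l A D c : ℝ}

lemma lintegral_rpow_neg_le (hp : 1 < p) (hs : 0 < s) (hab : a < b)
    (hc : 0 ≤ c) (hcrit : -s * A + (s + 1) * D - (s + p) * c * K = 0)
    (hy : ∀ y, 1 ≤ y → y ^ (-s) ≤ A - D * y + c * y ^ p)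
    (hf0 : ∀ x, 0 ≤ f x) (hf : Integrable f) (hfp : Integrable fun x => f x ^ p)
    (hl : ∫ x in Ioo a b, f x = l * (b - a))
    (hRH : ∀ c d, a ≤ c → c < d → d ≤ b → ∫ x in Ioo c d, f x ^ p ≤
      K * (d - c) * ((∫ x in Ioo c d, f x) / (d - c)) ^ p)
    (hl0 : 0 < l) :
    ∫⁻ x in Ioo a b, ENNReal.ofReal (f x) ^ (-s) ≤
      ENNReal.ofReal ((A - D + c * K) * l ^ (-s) * (b - a)) := by
  set M := ENNReal.ofReal ((A - D + c * K) * l ^ (-s) * (b - a)) with hM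
  set e : ℕ → ℝ := fun n => l / ((n : ℝ) + 2) with he
  have he0 : ∀ n, 0 < e n := fun n => by positivity
  have hel : ∀ n, e n < l := fun n => div_lt_self hl0 (by linarith [n.cast_nonneg (α := ℝ)])
  have hanti : Antitone e := fun m n hmn => by
    have : (m : ℝ) ≤ n := by exact_mod_cast hmn
    exact div_le_div_of_nonneg_left hl0.le (by positivity) (by linarith)
  have hlim : Filter.Tendsto e Filter.atTop (nhds 0) :=
    Filter.Tendsto.div_atTop tendsto_const_nhds
      (Filter.tendsto_atTop_add_const_right _ _ tendsto_natCast_atTop_atTop)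
  have hest := fun n => truncated_estimate hp hs hab hc hcrit hy hf0 hf hfp hl hRH (he0 n) (hel n)
  have hnull : volume (⋂ n, lowSet f a b (e n)) = 0 := by
    have h1 : ∀ n, volume (⋂ n, lowSet f a b (e n)) ≤ ENNReal.ofReal (e n ^ s) * M := fun n => by
      have h2 : ENNReal.ofReal (e n ^ s) * ENNReal.ofReal (e n ^ (-s)) = 1 := by
        rw [← ENNReal.ofReal_mul (Real.rpow_nonneg (he0 n).le _), ← Real.rpow_add (he0 n)]
        simp
      calc volume (⋂ n, lowSet f a b (e n)) ≤ volume (lowSet f a b (e n)) :=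
            measure_mono (iInter_subset _ n)
        _ = ENNReal.ofReal (e n ^ s) *
            (ENNReal.ofReal (e n ^ (-s)) * volume (lowSet f a b (e n))) := by
          rw [← mul_assoc, h2, one_mul]
        _ ≤ _ := by gcongr; exact (hest n).1
    have h3 : Filter.Tendsto (fun n => ENNReal.ofReal (e n ^ s) * M) Filter.atTop (nhds 0) := by
      have h4 : Filter.Tendsto (fun n => e n ^ s) Filter.atTop (nhds 0) := by
        simpa [Real.zero_rpow hs.ne'] using hlim.rpow_const (p := s) (Or.inr hs.le)
      have h5 := ENNReal.tendsto_ofReal h4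
      have h6 := ENNReal.Tendsto.mul_const (b := M) h5 (Or.inr (by simp [hM]))
      simpa using h6
    exact le_antisymm (ge_of_tendsto' h3 h1) bot_le
  have hset : (⋃ n, Ioo a b \ lowSet f a b (e n) : Set ℝ) =ᵐ[volume] Ioo a b := by
    rw [← sdiff_iInter]
    exact sdiff_null_ae_eq_self hnull
  rw [← setLIntegral_congr hset, setLIntegral_iUnion_of_directed]
  · refine iSup_le fun n => le_trans (le_of_eq ?_) (hest n).2
    have hm : MeasurableSet (Ioo a b \ lowSet f a b (e n)) :=
      measurableSet_Ioo.diff (isOpen_lowSet hf _).measurableSet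
    refine setLIntegral_congr_fun_ae hm ?_
    filter_upwards [ae_le_of_notMem_lowSet (a := a) (b := b) hf] with x hx hxm
    exact ENNReal.ofReal_rpow_of_pos ((he0 n).trans_le (hx hxm.1 _ hxm.2))
  · have hmono : Monotone fun n => Ioo a b \ lowSet f a b (e n) := fun m n hmn =>
      sdiff_subset_sdiff_right (lowSet_mono (hanti hmn))
    exact hmono.directed_le

end bound

lemma toReal_avgE (g : ℝ → ℝ≥0∞) {c d : ℝ} (hcd : c ≤ d) :
    (avgE g c d).toReal = (∫⁻ t in Ioo c d, g t).toReal / (d - c) := by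
  rw [avgE, ENNReal.toReal_div, ENNReal.toReal_ofReal (sub_nonneg.2 hcd)]

lemma avgE_ne_top {g : ℝ → ℝ≥0∞} {c d : ℝ} (hcd : c < d)
    (hg : ∫⁻ t in Ioo c d, g t ≠ ⊤) : avgE g c d ≠ ⊤ :=
  ENNReal.div_ne_top hg (by simpa using hcd)

section memRH

variable {p δ a b : ℝ} {w : ℝ → ℝ≥0∞}

lemma MemRH.mono {A B : ℝ} (hw : MemRH p δ A B w) (ha : A ≤ a) (hb : b ≤ B) :
    MemRH p δ a b w :=
  ⟨hw.1, ((lintegral_mono_set (Ioo_subset_Ioo ha hb)).trans_lt hw.2.1.lt_top).ne,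
    fun c d hc hcd hd => hw.2.2 c d (ha.trans hc) hcd (hd.trans hb)⟩

lemma MemRH.lintegral_ne_top (hw : MemRH p δ a b w) {c d : ℝ} (hc : a ≤ c) (hd : d ≤ b) :
    ∫⁻ t in Ioo c d, w t ≠ ⊤ :=
  (hw.mono hc hd).2.1

lemma MemRH.lintegral_rpow_ne_top (hp : 0 < p) (hw : MemRH p δ a b w) {c d : ℝ}
    (hc : a ≤ c) (hcd : c < d) (hd : d ≤ b) : ∫⁻ t in Ioo c d, w t ^ p ≠ ⊤ := by
  have h1 : avgE (fun t => w t ^ p) c d ≠ ⊤ := by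
    refine ne_top_of_le_ne_top (ENNReal.mul_ne_top ?_ ?_) (hw.2.2 c d hc hcd hd)
    · exact ENNReal.rpow_ne_top_of_nonneg hp.le ENNReal.ofReal_ne_top
    · exact ENNReal.rpow_ne_top_of_nonneg hp.le (avgE_ne_top hcd (hw.lintegral_ne_top hc hd))
  intro h
  exact h1 (by rw [avgE, h, ENNReal.top_div_of_ne_top ENNReal.ofReal_ne_top])

lemma MemRH.toReal_le (hp : 0 < p) (hδ : 0 ≤ δ) (hw : MemRH p δ a b w) {c d : ℝ}
    (hc : a ≤ c) (hcd : c < d) (hd : d ≤ b) :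
    (∫⁻ t in Ioo c d, w t ^ p).toReal ≤
      δ ^ p * (d - c) * ((∫⁻ t in Ioo c d, w t).toReal / (d - c)) ^ p := by
  have hT : ENNReal.ofReal δ ^ p * avgE w c d ^ p ≠ ⊤ := by
    refine ENNReal.mul_ne_top ?_ ?_
    · exact ENNReal.rpow_ne_top_of_nonneg hp.le ENNReal.ofReal_ne_top
    · exact ENNReal.rpow_ne_top_of_nonneg hp.le (avgE_ne_top hcd (hw.lintegral_ne_top hc hd))
  have h := ENNReal.toReal_mono hT (hw.2.2 c d hc hcd hd)
  rw [ENNReal.toReal_mul, ← ENNReal.toReal_rpow, ← ENNReal.toReal_rpow, toReal_avgE _ hcd.le,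
    toReal_avgE _ hcd.le, ENNReal.toReal_ofReal hδ, div_le_iff₀ (sub_pos.2 hcd)] at h
  linarith

/-- The estimate for negative powers of a weight satisfying a reverse Hölder inequality. -/
lemma MemRH.avgE_rpow_neg_le {s k : ℝ} (hp : 1 < p) (hδ : 0 ≤ δ) (hs : 0 < s) (hk : 1 < k)
    (hks : (k - 1) * s < 1) (hK : k ^ p = δ ^ p * (1 + p * (k - 1))) (hab : a < b)
    (hw : MemRH p δ a b w) (h0 : avgE w a b ≠ 0) :
    avgE (fun t => w t ^ (-s)) a b ≤
      ENNReal.ofReal (k ^ (-s) / (1 - (k - 1) * s) * (avgE w a b).toReal ^ (-s)) := by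
  have hba : 0 < b - a := sub_pos.2 hab
  have hp0 : 0 < p := by linarith
  have hfin : ∀ᵐ x, x ∈ Ioo a b → w x < ⊤ :=
    (ae_restrict_iff' measurableSet_Ioo).1 (ae_lt_top hw.1 hw.2.1)
  set f : ℝ → ℝ := (Ioo a b).indicator fun x => (w x).toReal with hf
  have hfp : (fun x => f x ^ p) = (Ioo a b).indicator fun x => (w x ^ p).toReal := by
    ext x
    by_cases hx : x ∈ Ioo a b
    · simp [hf, hx, ENNReal.toReal_rpow]
    · simp [hf, hx, Real.zero_rpow hp0.ne']
  have hae : ∀ {c d}, a ≤ c → d ≤ b → ∀ᵐ x ∂volume.restrict (Ioo c d), w x < ⊤ := by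
    intro c d hc hd
    rw [ae_restrict_iff' measurableSet_Ioo]
    exact hfin.mono fun x hx hxc => hx (Ioo_subset_Ioo hc hd hxc)
  have e1 : ∀ {c d}, a ≤ c → d ≤ b →
      ∫ x in Ioo c d, f x = (∫⁻ x in Ioo c d, w x).toReal := by
    intro c d hc hd
    rw [← integral_toReal hw.1.aemeasurable (hae hc hd)]
    exact setIntegral_congr_fun measurableSet_Ioo fun x hx =>
      indicator_of_mem (Ioo_subset_Ioo hc hd hx) _
  have e2 : ∀ {c d}, a ≤ c → d ≤ b →
      ∫ x in Ioo c d, f x ^ p = (∫⁻ x in Ioo c d, w x ^ p).toReal := by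
    intro c d hc hd
    rw [← integral_toReal (hw.1.pow_const p).aemeasurable
      ((hae hc hd).mono fun x hx => ENNReal.rpow_lt_top_of_nonneg hp0.le hx.ne)]
    refine setIntegral_congr_fun measurableSet_Ioo fun x hx => ?_
    exact (congrFun hfp x).trans (indicator_of_mem (Ioo_subset_Ioo hc hd hx) _)
  obtain ⟨A, D, c, hc, hC, hcrit, hy⟩ := exists_supersolution hp hs hk hks hK
  have hl0 : 0 < (avgE w a b).toReal := ENNReal.toReal_pos h0 (avgE_ne_top hab hw.2.1)
  have key := lintegral_rpow_neg_le (f := f) (a := a) (b := b) (K := δ ^ p)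
    (l := (avgE w a b).toReal) hp hs hab hc hcrit hy
    (fun x => indicator_nonneg (fun _ _ => ENNReal.toReal_nonneg) x)
    ((integrable_indicator_iff measurableSet_Ioo).2
      (integrable_toReal_of_lintegral_ne_top hw.1.aemeasurable hw.2.1))
    (by
      rw [hfp]
      exact (integrable_indicator_iff measurableSet_Ioo).2
        (integrable_toReal_of_lintegral_ne_top (hw.1.pow_const p).aemeasurable
          (hw.lintegral_rpow_ne_top hp0 le_rfl hab le_rfl)))
    (by rw [e1 le_rfl le_rfl, toReal_avgE _ hab.le, div_mul_cancel₀ _ hba.ne'])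
    (fun c d hc hcd hd => by
      rw [e1 hc hd, e2 hc hd]
      exact hw.toReal_le hp0 hδ hc hcd hd) hl0
  have e3 : ∫⁻ x in Ioo a b, ENNReal.ofReal (f x) ^ (-s) = ∫⁻ x in Ioo a b, w x ^ (-s) := by
    refine setLIntegral_congr_fun_ae measurableSet_Ioo ?_
    filter_upwards [hfin] with x hx hxab
    rw [hf, indicator_of_mem hxab, ENNReal.ofReal_toReal (hx hxab).ne]
  rw [e3, hC] at key
  rw [avgE]
  refine ENNReal.div_le_of_le_mul ?_
  rwa [← ENNReal.ofReal_mul' hba.le]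

lemma MemRH.avgE_mul_avgE_rpow_le {k q : ℝ} (hp : 1 < p) (hδ : 0 ≤ δ) (hk : 1 < k) (hkq : k < q)
    (hK : k ^ p = δ ^ p * (1 + p * (k - 1))) (hab : a < b) (hw : MemRH p δ a b w) :
    avgE w a b * avgE (fun t => w t ^ (1 - q / (q - 1))) a b ^ (q - 1) ≤
      ENNReal.ofReal (1 / k * ((q - 1) / (q - k)) ^ (q - 1)) := by
  by_cases h0 : avgE w a b = 0
  · simp [h0]
  have hq : 0 < q - 1 := by linarith
  have hqk : 0 < q - k := by linarith
  have hk0 : 0 < k := by linarith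
  have hs : 1 - q / (q - 1) = -(1 / (q - 1)) := by field_simp; ring
  have hks : 1 - (k - 1) * (1 / (q - 1)) = (q - k) / (q - 1) := by field_simp; ring
  have hm := hw.avgE_rpow_neg_le hp hδ (one_div_pos.2 hq) hk
    (by rw [← sub_pos, hks]; positivity) hK hab h0
  have hT := avgE_ne_top hab hw.2.1
  have hl0 : 0 < (avgE w a b).toReal := ENNReal.toReal_pos h0 hT
  set l := (avgE w a b).toReal with hl
  rw [hs]
  refine (mul_le_mul_right (ENNReal.rpow_le_rpow hm hq.le) _).trans (le_of_eq ?_)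
  rw [← ENNReal.ofReal_toReal hT, ← hl, hks, ENNReal.ofReal_rpow_of_nonneg (by positivity) hq.le,
    ← ENNReal.ofReal_mul hl0.le, Real.mul_rpow (by positivity) (by positivity),
    Real.div_rpow (by positivity) (by positivity), Real.div_rpow hqk.le hq.le,
    Real.div_rpow hq.le hqk.le, ← Real.rpow_mul hk0.le, ← Real.rpow_mul hl0.le]
  have e : -(1 / (q - 1)) * (q - 1) = -1 := by field_simp
  rw [e, Real.rpow_neg_one, Real.rpow_neg_one]
  congr 1
  field_simp

end memRH

/-! ### Power weights -/

lemma rpow_mul_rpow_add_rpow_mul_rpow_le {P Q x y θ : ℝ} (hP : 0 < P) (hQ : 0 < Q) (hx : 0 ≤ x)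
    (hxP : x ≤ P) (hy : 0 ≤ y) (hyQ : y ≤ Q) (hθ : 0 ≤ θ) (hθ1 : θ ≤ 1) :
    (P - x) ^ θ * (Q - y) ^ (1 - θ) + x ^ θ * y ^ (1 - θ) ≤ P ^ θ * Q ^ (1 - θ) := by
  have h1 := Real.geom_mean_le_arith_mean2_weighted hθ (sub_nonneg.2 hθ1)
    (div_nonneg (sub_nonneg.2 hxP) hP.le) (div_nonneg (sub_nonneg.2 hyQ) hQ.le) (by ring)
  have h2 := Real.geom_mean_le_arith_mean2_weighted hθ (sub_nonneg.2 hθ1)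
    (div_nonneg hx hP.le) (div_nonneg hy hQ.le) (by ring)
  rw [Real.div_rpow (sub_nonneg.2 hxP) hP.le, Real.div_rpow (sub_nonneg.2 hyQ) hQ.le] at h1
  rw [Real.div_rpow hx hP.le, Real.div_rpow hy hQ.le] at h2
  have h3 := add_le_add h1 h2
  have e : θ * ((P - x) / P) + (1 - θ) * ((Q - y) / Q) + (θ * (x / P) + (1 - θ) * (y / Q)) = 1 := by
    field_simp
    ring
  have hP' := Real.rpow_pos_of_pos hP θ
  have hQ' := Real.rpow_pos_of_pos hQ (1 - θ)
  rw [e, div_mul_div_comm, div_mul_div_comm, ← add_div, div_le_one (by positivity)] at h3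
  exact h3

lemma rpow_sub_rpow_mul_rpow_le {a b α p : ℝ} (ha : 0 ≤ a) (hab : a < b) (hα : 0 ≤ α)
    (hp : 1 < p) :
    (b ^ (α * p + 1) - a ^ (α * p + 1)) * (b - a) ^ (p - 1) ≤ (b ^ (α + 1) - a ^ (α + 1)) ^ p := by
  have hb : 0 < b := ha.trans_lt hab
  have hp0 : 0 < p := by linarith
  have hm : a ^ (α * p + 1) ≤ b ^ (α * p + 1) := Real.rpow_le_rpow ha hab.le (by positivity)
  have h := rpow_mul_rpow_add_rpow_mul_rpow_le (θ := 1 / p) (Real.rpow_pos_of_pos hb (α * p + 1)) hb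
    (Real.rpow_nonneg ha _) hm ha hab.le (by positivity) ((div_le_one hp0).2 hp.le)
  have e : ∀ x : ℝ, 0 ≤ x → (x ^ (α * p + 1)) ^ (1 / p) * x ^ (1 - 1 / p) = x ^ (α + 1) := by
    intro x hx
    have h1 : 0 < 1 - 1 / p := sub_pos.2 ((div_lt_one hp0).2 hp)
    rw [← Real.rpow_mul hx, ← Real.rpow_add_of_nonneg hx (by positivity) h1.le]
    congr 1
    field_simp
    ring
  rw [e a ha, e b hb.le] at h
  have hba : 0 ≤ b - a := sub_nonneg.2 hab.le
  have h2 := Real.rpow_le_rpow (mul_nonneg (Real.rpow_nonneg (sub_nonneg.2 hm) _)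
    (Real.rpow_nonneg hba _)) (le_sub_iff_add_le.2 h) hp0.le
  rw [Real.mul_rpow (Real.rpow_nonneg (sub_nonneg.2 hm) _) (Real.rpow_nonneg hba _),
    ← Real.rpow_mul (sub_nonneg.2 hm), ← Real.rpow_mul hba] at h2
  have e1 : 1 / p * p = 1 := by field_simp
  have e2 : (1 - 1 / p) * p = p - 1 := by field_simp
  rwa [e1, e2, Real.rpow_one] at h2

lemma avgE_ofReal_rpow {a b r : ℝ} (ha : 0 ≤ a) (hab : a < b) (hr : -1 < r) :
    avgE (fun t => ENNReal.ofReal (t ^ r)) a b =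
      ENNReal.ofReal ((b ^ (r + 1) - a ^ (r + 1)) / (r + 1) / (b - a)) := by
  have hi : IntegrableOn (fun t : ℝ => t ^ r) (Ioo a b) :=
    ((intervalIntegral.intervalIntegrable_rpow' (a := a) (b := b) hr).1).mono_set
      Ioo_subset_Ioc_self
  rw [ENNReal.ofReal_div_of_pos (sub_pos.2 hab), avgE, ← integral_rpow (Or.inl hr),
    intervalIntegral.integral_of_le hab.le, integral_Ioc_eq_integral_Ioo,
    ofReal_integral_eq_lintegral_ofReal hi]
  filter_upwards [ae_restrict_mem measurableSet_Ioo] with t ht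
  exact Real.rpow_nonneg (ha.trans ht.1.le) r

lemma avgE_ofReal_rpow_rpow {a b r s : ℝ} (ha : 0 ≤ a) (hab : a < b) (hr : -1 < r * s) :
    avgE (fun t => ENNReal.ofReal (t ^ r) ^ s) a b =
      ENNReal.ofReal ((b ^ (r * s + 1) - a ^ (r * s + 1)) / (r * s + 1) / (b - a)) := by
  rw [← avgE_ofReal_rpow ha hab hr, avgE, avgE]
  congr 1
  refine setLIntegral_congr_fun measurableSet_Ioo fun t ht => ?_
  have ht0 : 0 < t := ha.trans_lt ht.1
  rw [ENNReal.ofReal_rpow_of_pos (Real.rpow_pos_of_pos ht0 r), Real.rpow_mul ht0.le]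

lemma memRH_ofReal_rpow {p δ k B : ℝ} (hp : 1 < p) (hδ : 0 ≤ δ) (hk : 1 < k) (hB : 0 < B)
    (hK : k ^ p = δ ^ p * (1 + p * (k - 1))) :
    MemRH p δ 0 B fun t => ENNReal.ofReal (t ^ (k - 1)) := by
  have hp0 : 0 < p := by linarith
  have hk0 : 0 < k - 1 := by linarith
  refine ⟨by fun_prop, fun h => ?_, fun a b ha hab _ => ?_⟩
  · have := avgE_ofReal_rpow le_rfl hB (show -1 < k - 1 by linarith)
    rw [avgE, h, ENNReal.top_div_of_ne_top ENNReal.ofReal_ne_top] at this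
    exact ENNReal.ofReal_ne_top this.symm
  have hb : 0 < b := ha.trans_lt hab
  have hba : 0 < b - a := sub_pos.2 hab
  have hm : 0 ≤ b ^ (k - 1 + 1) - a ^ (k - 1 + 1) :=
    sub_nonneg.2 (Real.rpow_le_rpow ha hab.le (by linarith))
  rw [avgE_ofReal_rpow_rpow ha hab (by nlinarith), avgE_ofReal_rpow ha hab (by linarith),
    ENNReal.ofReal_rpow_of_nonneg hδ hp0.le, ENNReal.ofReal_rpow_of_nonneg (by positivity) hp0.le,
    ← ENNReal.ofReal_mul (by positivity)]
  refine ENNReal.ofReal_le_ofReal ?_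
  have h := rpow_sub_rpow_mul_rpow_le ha hab hk0.le hp
  have e1 : k - 1 + 1 = k := by ring
  have hkp : 0 < k ^ p := Real.rpow_pos_of_pos (by linarith) p
  have hd : δ ^ p / k ^ p = 1 / ((k - 1) * p + 1) := by
    rw [div_eq_div_iff hkp.ne' (by positivity), hK]
    ring
  rw [Real.div_rpow (by positivity) hba.le, Real.div_rpow hm (by linarith), e1]
  rw [e1] at h
  have e2 : (b - a) ^ p = (b - a) ^ (p - 1) * (b - a) := by
    rw [← Real.rpow_add_one hba.ne', sub_add_cancel]
  have e3 : δ ^ p * ((b ^ k - a ^ k) ^ p / k ^ p / (b - a) ^ p) =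
      1 / ((k - 1) * p + 1) * ((b ^ k - a ^ k) ^ p / (b - a) ^ p) := by
    rw [← hd]
    ring
  have hpos := Real.rpow_pos_of_pos hba (p - 1)
  rw [e3, e2, div_div, one_div_mul_eq_div, div_div, div_le_div_iff₀ (by positivity) (by positivity)]
  have hD : 0 ≤ ((k - 1) * p + 1) * (b - a) := by positivity
  nlinarith [mul_le_mul_of_nonneg_left h hD]

lemma avgE_mul_avgE_rpow_ofReal_rpow {k q : ℝ} (hk : 1 < k) (hkq : k < q) :
    avgE (fun t => ENNReal.ofReal (t ^ (k - 1))) 0 1 *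
      avgE (fun t => ENNReal.ofReal (t ^ (k - 1)) ^ (1 - q / (q - 1))) 0 1 ^ (q - 1) =
      ENNReal.ofReal (1 / k * ((q - 1) / (q - k)) ^ (q - 1)) := by
  have hq : 0 < q - 1 := by linarith
  have hqk : 0 < q - k := by linarith
  have e : (k - 1) * (1 - q / (q - 1)) + 1 = (q - k) / (q - 1) := by field_simp; ring
  have e0 : 0 < (q - k) / (q - 1) := by positivity
  rw [avgE_ofReal_rpow le_rfl one_pos (by linarith),
    avgE_ofReal_rpow_rpow le_rfl one_pos (by linarith), e, Real.zero_rpow e0.ne',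
    sub_add_cancel, Real.zero_rpow (by linarith), Real.one_rpow, Real.one_rpow]
  simp only [sub_zero, div_one]
  rw [ENNReal.ofReal_rpow_of_nonneg (by positivity) hq.le, ← ENNReal.ofReal_mul (by positivity),
    one_div_div]

theorem statement1 (p δ qs q : ℝ) (hp : 1 < p) (hδ : 1 < δ)
    (hqs1 : 1 < qs) (hqs : ((qs / δ) ^ p - 1) / (qs - 1) = p)
    (hq : qs < q) :
    sSup { y : ℝ≥0∞ | ∃ w : ℝ → ℝ≥0∞, MemRH p δ 0 1 w ∧
        ∃ a b : ℝ, 0 ≤ a ∧ a < b ∧ b ≤ 1 ∧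
          y = avgE w a b * (avgE (fun t => w t ^ (1 - q / (q - 1))) a b) ^ (q - 1) }
      = ENNReal.ofReal ((1 / qs) * ((q - 1) / (q - qs)) ^ (q - 1)) := by
  have hδ0 : 0 < δ := by linarith
  have hK : qs ^ p = δ ^ p * (1 + p * (qs - 1)) := by
    rw [div_eq_iff (by linarith), Real.div_rpow (by linarith) hδ0.le, sub_eq_iff_eq_add,
      div_eq_iff (Real.rpow_pos_of_pos hδ0 p).ne'] at hqs
    linarith
  refine le_antisymm (sSup_le ?_) (le_sSup ?_)
  · rintro y ⟨w, hw, a, b, ha, hab, hb, rfl⟩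
    exact (hw.mono ha hb).avgE_mul_avgE_rpow_le hp hδ0.le hqs1 hq hK hab
  · exact ⟨_, memRH_ofReal_rpow hp hδ0.le hqs1 one_pos hK, 0, 1, le_rfl, one_pos, le_rfl,
      (avgE_mul_avgE_rpow_ofReal_rpow hqs1 hq).symm⟩
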